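/- With F = F0 + F+ + F−, in Mat_P(ℂ) the identity q·R·L = F·F0 + F+·F− + (q−1)^{−1}·((q^{k/2}·K1 + q^{(n−k)/2}·K2 − 2·I)·F0 + (q^{k/2}·K1 − I)·F+ + (q^{(n−k)/2}·K2 − I)·F−) + (q−1)^{−2}·(q^{n/2}·K1·K2 − q^{k/2}·K1 − q^{(n−k)/2}·K2 + I) holds. -/

import Mathlib

open scoped Classical

noncomputable section

variable {F V : Type} [Field F] [AddCommGroup V] [Module F V]

/-- `v` covers `u` in the projective geometry `P`. -/
def Covers (u v : Submodule F V) : Prop :=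
  u ≤ v ∧ Module.finrank F ↥v = Module.finrank F ↥u + 1

/-- `v` slash-covers `u` (relative to the fixed subspace `y`). -/
def SlashCovers (y u v : Submodule F V) : Prop :=
  Covers u v ∧ Module.finrank F ↥(v ⊓ y) = Module.finrank F ↥(u ⊓ y) + 1

/-- `v` backslash-covers `u` (relative to the fixed subspace `y`). -/
def BackslashCovers (y u v : Submodule F V) : Prop :=
  Covers u v ∧ Module.finrank F ↥(v ⊓ y) = Module.finrank F ↥(u ⊓ y)

/-- `q` raised to a real exponent, as a complex number. -/
def qpow (q : ℕ) (e : ℝ) : ℂ := (((q : ℝ) ^ e : ℝ) : ℂ)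

/-- The Gaussian bracket `[m] = (q^m - 1)/(q - 1)` as a rational number. -/
def gaussQ (q m : ℕ) : ℚ := ((q : ℚ) ^ m - 1) / ((q : ℚ) - 1)

/-- The Gaussian bracket `[m] = (q^m - 1)/(q - 1)` as a complex number. -/
def gaussC (q m : ℕ) : ℂ := ((q : ℂ) ^ m - 1) / ((q : ℂ) - 1)

/-- The diagonal matrix `K1`; the `(u,u)` entry is `q^(k/2 - i)` for `u ∈ P_{i,j}`. -/
def matK1 (q k : ℕ) (y : Submodule F V) : Matrix (Submodule F V) (Submodule F V) ℂ :=
  Matrix.diagonal fun u => qpow q ((k : ℝ) / 2 - (Module.finrank F ↥(u ⊓ y) : ℝ))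

/-- The diagonal matrix `K2`; the `(u,u)` entry is `q^(j - (n-k)/2)` for `u ∈ P_{i,j}`. -/
def matK2 (q n k : ℕ) (y : Submodule F V) : Matrix (Submodule F V) (Submodule F V) ℂ :=
  Matrix.diagonal fun u =>
    qpow q (((Module.finrank F ↥u : ℝ) - (Module.finrank F ↥(u ⊓ y) : ℝ))
      - ((n : ℝ) - (k : ℝ)) / 2)

/-- The 0-1 matrix `L1`; the `(u,v)` entry is `1` iff `v` slash-covers `u`. -/
def matL1 (y : Submodule F V) : Matrix (Submodule F V) (Submodule F V) ℂ :=
  Matrix.of fun u v => if SlashCovers y u v then (1 : ℂ) else 0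

/-- The 0-1 matrix `L2`; the `(u,v)` entry is `1` iff `v` backslash-covers `u`. -/
def matL2 (y : Submodule F V) : Matrix (Submodule F V) (Submodule F V) ℂ :=
  Matrix.of fun u v => if BackslashCovers y u v then (1 : ℂ) else 0

/-- `R1 = L1ᵀ`. -/
def matR1 (y : Submodule F V) : Matrix (Submodule F V) (Submodule F V) ℂ := Matrix.transpose (matL1 y)

/-- `R2 = L2ᵀ`. -/
def matR2 (y : Submodule F V) : Matrix (Submodule F V) (Submodule F V) ℂ := Matrix.transpose (matL2 y)

/-- `R = L1 · R2`. -/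
def matR [Fintype (Submodule F V)] (y : Submodule F V) :
    Matrix (Submodule F V) (Submodule F V) ℂ := matL1 y * matR2 y

/-- `L = R1 · L2`. -/
def matL [Fintype (Submodule F V)] (y : Submodule F V) :
    Matrix (Submodule F V) (Submodule F V) ℂ := matR1 y * matL2 y

/-- The 0-1 matrix `F0`. -/
def matF0 (y : Submodule F V) : Matrix (Submodule F V) (Submodule F V) ℂ :=
  Matrix.of fun u v =>
    if SlashCovers y u (u ⊔ v) ∧ SlashCovers y v (u ⊔ v) ∧
        BackslashCovers y (u ⊓ v) u ∧ BackslashCovers y (u ⊓ v) v then (1 : ℂ) else 0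

/-- The 0-1 matrix `F+`. -/
def matFp (y : Submodule F V) : Matrix (Submodule F V) (Submodule F V) ℂ :=
  Matrix.of fun u v =>
    if BackslashCovers y u (u ⊔ v) ∧ BackslashCovers y v (u ⊔ v) then (1 : ℂ) else 0

/-- The 0-1 matrix `F-`. -/
def matFm (y : Submodule F V) : Matrix (Submodule F V) (Submodule F V) ℂ :=
  Matrix.of fun u v =>
    if SlashCovers y (u ⊓ v) u ∧ SlashCovers y (u ⊓ v) v then (1 : ℂ) else 0

/-- The vertex set `X` of the Grassmann graph: `k`-dimensional subspaces of `V`. -/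
abbrev GrassVertex (F V : Type) [Field F] [AddCommGroup V] [Module F V] (k : ℕ) :=
  {z : Submodule F V // Module.finrank F ↥z = k}

/-- The Grassmann graph `J_q(n,k)`: vertices are adjacent iff their intersection
has dimension `k - 1`. -/
def Grass (F V : Type) [Field F] [AddCommGroup V] [Module F V] (k : ℕ) :
    SimpleGraph (GrassVertex F V k) :=
  SimpleGraph.fromRel fun a b => Module.finrank F ↥(a.1 ⊓ b.1) = k - 1

/-- `B_xy = {z ∈ Γ(x) : ∂(z,y) = ∂(x,y) + 1}`. -/
def Bset {k : ℕ} (x y : GrassVertex F V k) : Set (GrassVertex F V k) :=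
  {z | (Grass F V k).Adj x z ∧ (Grass F V k).dist z y = (Grass F V k).dist x y + 1}

/-- `C_xy = {z ∈ Γ(x) : ∂(z,y) = ∂(x,y) - 1}`. -/
def Cset {k : ℕ} (x y : GrassVertex F V k) : Set (GrassVertex F V k) :=
  {z | (Grass F V k).Adj x z ∧ (Grass F V k).dist z y = (Grass F V k).dist x y - 1}

/-- `A_xy = {z ∈ Γ(x) : ∂(z,y) = ∂(x,y)}`. -/
def Aset {k : ℕ} (x y : GrassVertex F V k) : Set (GrassVertex F V k) :=
  {z | (Grass F V k).Adj x z ∧ (Grass F V k).dist z y = (Grass F V k).dist x y}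

/-- `A0_xy`. -/
def A0set {k : ℕ} (x y : GrassVertex F V k) : Set (GrassVertex F V k) :=
  {z | (Grass F V k).Adj x z ∧
    SlashCovers y.1 z.1 (z.1 ⊔ x.1) ∧ SlashCovers y.1 x.1 (z.1 ⊔ x.1) ∧
    BackslashCovers y.1 (z.1 ⊓ x.1) z.1 ∧ BackslashCovers y.1 (z.1 ⊓ x.1) x.1}

/-- `A+_xy`. -/
def Apset {k : ℕ} (x y : GrassVertex F V k) : Set (GrassVertex F V k) :=
  {z | (Grass F V k).Adj x z ∧
    BackslashCovers y.1 z.1 (z.1 ⊔ x.1) ∧ BackslashCovers y.1 x.1 (z.1 ⊔ x.1)}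

/-- `A-_xy`. -/
def Amset {k : ℕ} (x y : GrassVertex F V k) : Set (GrassVertex F V k) :=
  {z | (Grass F V k).Adj x z ∧
    SlashCovers y.1 (z.1 ⊓ x.1) z.1 ∧ SlashCovers y.1 (z.1 ⊓ x.1) x.1}

/-- The edge `wz` has type `0`. -/
def EdgeType0 {k : ℕ} (y w z : GrassVertex F V k) : Prop :=
  SlashCovers y.1 w.1 (w.1 ⊔ z.1) ∧ SlashCovers y.1 z.1 (w.1 ⊔ z.1) ∧
  BackslashCovers y.1 (w.1 ⊓ z.1) w.1 ∧ BackslashCovers y.1 (w.1 ⊓ z.1) z.1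

/-- The edge `wz` has type `+`. -/
def EdgeTypeP {k : ℕ} (y w z : GrassVertex F V k) : Prop :=
  BackslashCovers y.1 w.1 (w.1 ⊔ z.1) ∧ BackslashCovers y.1 z.1 (w.1 ⊔ z.1)

/-- The edge `wz` has type `-`. -/
def EdgeTypeM {k : ℕ} (y w z : GrassVertex F V k) : Prop :=
  SlashCovers y.1 (w.1 ⊓ z.1) w.1 ∧ SlashCovers y.1 (w.1 ⊓ z.1) z.1

open Module Submodule

section Dimension

variable [FiniteDimensional F V]

theorem finrank_sup_add_finrank_inf (u v : Submodule F V) :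
    finrank F ↥(u ⊔ v) + finrank F ↥(u ⊓ v) = finrank F ↥u + finrank F ↥v :=
  finrank_sup_add_finrank_inf_eq u v

theorem finrank_inf_le_of_le {u v : Submodule F V} (y : Submodule F V) (h : u ≤ v) :
    finrank F ↥(u ⊓ y) ≤ finrank F ↥(v ⊓ y) :=
  finrank_mono (inf_le_inf_right y h)

/-- Intersecting with `y` cannot increase relative dimensions. -/
theorem finrank_inf_add_finrank_le {u v : Submodule F V} (y : Submodule F V) (h : u ≤ v) :
    finrank F ↥(v ⊓ y) + finrank F ↥u ≤ finrank F ↥v + finrank F ↥(u ⊓ y) := by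
  have h1 := finrank_sup_add_finrank_inf (v ⊓ y) u
  have h2 : v ⊓ y ⊓ u = u ⊓ y := by
    rw [inf_right_comm, inf_eq_right.mpr h]
  have h3 : finrank F ↥(v ⊓ y ⊔ u) ≤ finrank F ↥v := finrank_mono (sup_le inf_le_left h)
  rw [h2] at h1
  omega

theorem finrank_inf_add_finrank_inf_le (u v y : Submodule F V) :
    finrank F ↥(u ⊓ y) + finrank F ↥(v ⊓ y) ≤
      finrank F ↥((u ⊔ v) ⊓ y) + finrank F ↥((u ⊓ v) ⊓ y) := by
  have h1 := finrank_sup_add_finrank_inf (u ⊓ y) (v ⊓ y)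
  have h2 : finrank F ↥(u ⊓ y ⊔ v ⊓ y) ≤ finrank F ↥((u ⊔ v) ⊓ y) :=
    finrank_mono (sup_le (inf_le_inf_right y le_sup_left) (inf_le_inf_right y le_sup_right))
  rw [← inf_inf_distrib_right] at h1
  omega

theorem finrank_sup_inf_add (y : Submodule F V) {v u : Submodule F V} (h : v ≤ u) :
    finrank F ↥(v ⊔ u ⊓ y) + finrank F ↥(v ⊓ y) = finrank F ↥v + finrank F ↥(u ⊓ y) := by
  have h1 := finrank_sup_add_finrank_inf v (u ⊓ y)
  rwa [← inf_assoc, inf_eq_left.mpr h] at h1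

theorem Covers.eq_sup {u v w : Submodule F V} (huw : Covers u w) (hvw : Covers v w)
    (hne : u ≠ v) : w = u ⊔ v := by
  have hle : u ⊔ v ≤ w := sup_le huw.1 hvw.1
  refine (eq_of_le_of_finrank_eq hle (le_antisymm (finrank_mono hle) ?_)).symm
  by_contra hlt
  have h1 := huw.2
  have h2 := hvw.2
  have h3 : finrank F ↥u ≤ finrank F ↥(u ⊔ v) := finrank_mono le_sup_left
  have hu : u = u ⊔ v := eq_of_le_of_finrank_eq le_sup_left (by omega)
  have hv : v = u ⊔ v := eq_of_le_of_finrank_eq le_sup_right (by omega)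
  exact hne (hu.trans hv.symm)

theorem Covers.eq_inf {u v w : Submodule F V} (huw : Covers w u) (hvw : Covers w v)
    (hne : u ≠ v) : w = u ⊓ v := by
  have hle : w ≤ u ⊓ v := le_inf huw.1 hvw.1
  refine eq_of_le_of_finrank_eq hle (le_antisymm (finrank_mono hle) ?_)
  by_contra hlt
  have h1 := huw.2
  have h2 := hvw.2
  have h3 : finrank F ↥(u ⊓ v) ≤ finrank F ↥u := finrank_mono inf_le_left
  have hu : u ⊓ v = u := eq_of_le_of_finrank_eq inf_le_left (by omega)
  have hv : u ⊓ v = v := eq_of_le_of_finrank_eq inf_le_right (by omega)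
  exact hne (hu.symm.trans hv)

theorem covers_sup_span_singleton {u : Submodule F V} {x : V} (hx : x ∉ u) :
    Covers u (u ⊔ span F {x}) := by
  refine ⟨le_sup_left, ?_⟩
  have hx0 : x ≠ 0 := fun h => hx (h ▸ u.zero_mem)
  have h1 := finrank_sup_add_finrank_inf u (span F {x})
  have h2 : u ⊓ span F {x} = ⊥ := (disjoint_span_singleton_of_notMem hx).eq_bot
  rwa [h2, finrank_bot, finrank_span_singleton hx0, add_zero] at h1

theorem Covers.sup_span_singleton_eq_iff {u w : Submodule F V} (h : Covers u w) {x : V}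
    (hx : x ∉ u) : u ⊔ span F {x} = w ↔ x ∈ w := by
  refine ⟨fun hw => hw ▸ mem_sup_right (mem_span_singleton_self x), fun hxw => ?_⟩
  refine eq_of_le_of_finrank_eq (sup_le h.1 ((span_singleton_le_iff_mem x w).mpr hxw)) ?_
  rw [(covers_sup_span_singleton hx).2, h.2]

theorem dualAnnihilator_covers_iff {u w : Submodule F V} :
    Covers u.dualAnnihilator w.dualAnnihilator ↔ Covers w u := by
  have h1 := Subspace.finrank_add_finrank_dualAnnihilator_eq u
  have h2 := Subspace.finrank_add_finrank_dualAnnihilator_eq w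
  unfold Covers
  rw [Subspace.dualAnnihilator_le_dualAnnihilator_iff]
  exact and_congr_right fun _ => by omega

theorem slashCovers_and_le_iff {y u v w : Submodule F V} (h : v ≤ u) :
    SlashCovers y v w ∧ w ≤ u ↔ Covers v w ∧ w ≤ v ⊔ u ⊓ y := by
  constructor
  · rintro ⟨⟨hc, hd⟩, hle⟩
    refine ⟨hc, ?_⟩
    have h1 := finrank_sup_inf_add y hc.1
    have hsub : v ⊔ w ⊓ y ≤ w := sup_le hc.1 inf_le_left
    have h2 := hc.2
    rw [← eq_of_le_of_finrank_eq hsub (by omega)]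
    exact sup_le_sup_left (inf_le_inf_right y hle) v
  · rintro ⟨hc, hle⟩
    refine ⟨⟨hc, ?_⟩, hle.trans (sup_le h inf_le_left)⟩
    have h1 := finrank_sup_inf_add y hc.1
    have h2 := hc.2
    have hw : w = v ⊔ w ⊓ y := by
      have hmod : (v ⊔ y) ⊓ w = v ⊔ y ⊓ w := (sup_inf_assoc_of_le y hc.1)
      rw [inf_comm w y, ← hmod, eq_comm, inf_eq_right]
      exact hle.trans (sup_le_sup_left inf_le_right v)
    rw [← hw] at h1
    omega

theorem covers_iff_slashCovers_or_backslashCovers {y v w : Submodule F V} :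
    Covers v w ↔ SlashCovers y v w ∨ BackslashCovers y v w := by
  refine ⟨fun hc => ?_, fun h => h.elim And.left And.left⟩
  have h1 := finrank_inf_le_of_le y hc.1
  have h2 := finrank_inf_add_finrank_le y hc.1
  have h3 := hc.2
  by_cases h4 : finrank F ↥(w ⊓ y) = finrank F ↥(v ⊓ y)
  · exact Or.inr ⟨hc, h4⟩
  · exact Or.inl ⟨hc, by omega⟩

end Dimension

theorem card_filter_mem_notMem [Fintype F] [Fintype V] {u w : Submodule F V} (h : u ≤ w) :
    (Finset.univ.filter fun x : V => x ∈ w ∧ x ∉ u).card + Fintype.card F ^ finrank F ↥u =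
      Fintype.card F ^ finrank F ↥w := by
  have hc (s : Submodule F V) :
      (Finset.univ.filter fun x : V => x ∈ s).card = Fintype.card F ^ finrank F ↥s := by
    rw [← Module.card_eq_pow_finrank (K := F) (V := ↥s), Fintype.card_subtype]
  rw [← hc u, ← hc w, ← Finset.card_union_of_disjoint]
  · congr 1
    ext x
    have := @h x
    simp only [Finset.mem_union, Finset.mem_filter, Finset.mem_univ, true_and]
    tauto
  · rw [Finset.disjoint_left]
    simp

section Counting

variable [Fintype F] [FiniteDimensional F V]

theorem card_cast_sub_one_ne_zero : ((Fintype.card F : ℂ) - 1) ≠ 0 :=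
  sub_ne_zero.mpr (by exact_mod_cast Fintype.one_lt_card.ne')

/-- The number of subspaces of `a` covering a given subspace `u` of `a`. -/
theorem card_covers_le [Fintype (Submodule F V)] {u a : Submodule F V} (h : u ≤ a) :
    ((Finset.univ.filter fun w => Covers u w ∧ w ≤ a).card : ℂ) =
      gaussC (Fintype.card F) (finrank F ↥a - finrank F ↥u) := by
  have : Finite V := Module.finite_of_finite F
  have := Fintype.ofFinite V
  set S := Finset.univ.filter fun w => Covers u w ∧ w ≤ a with hS
  have hmaps : Set.MapsTo (fun x => u ⊔ span F {x})
      (Finset.univ.filter fun x : V => x ∈ a ∧ x ∉ u : Set V) S := by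
    intro x hx
    simp only [Finset.coe_filter, Finset.mem_univ, true_and, Set.mem_ofPred_eq] at hx
    simp only [hS, Finset.coe_filter, Finset.mem_univ, true_and, Set.mem_ofPred_eq]
    exact ⟨covers_sup_span_singleton hx.2,
      sup_le h ((span_singleton_le_iff_mem x a).mpr hx.1)⟩
  have hsum := Finset.card_eq_sum_card_fiberwise hmaps
  have hfib : ∀ w ∈ S, ((((Finset.univ.filter fun x : V => x ∈ a ∧ x ∉ u).filter
      fun x => u ⊔ span F {x} = w).card : ℕ) : ℂ) =
        (Fintype.card F : ℂ) ^ finrank F ↥u * ((Fintype.card F : ℂ) - 1) := by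
    intro w hw
    obtain ⟨hcov, hle⟩ := (Finset.mem_filter.mp hw).2
    have heq : ((Finset.univ.filter fun x : V => x ∈ a ∧ x ∉ u).filter
        fun x => u ⊔ span F {x} = w) = Finset.univ.filter fun x : V => x ∈ w ∧ x ∉ u := by
      ext x
      simp only [Finset.mem_filter, Finset.mem_univ, true_and]
      constructor
      · rintro ⟨⟨-, hxu⟩, hx⟩
        exact ⟨(hcov.sup_span_singleton_eq_iff hxu).mp hx, hxu⟩
      · rintro ⟨hxw, hxu⟩
        exact ⟨⟨hle hxw, hxu⟩, (hcov.sup_span_singleton_eq_iff hxu).mpr hxw⟩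
    have hcard := card_filter_mem_notMem hcov.1
    rw [← heq, hcov.2] at hcard
    have hcard' := congrArg (Nat.cast : ℕ → ℂ) hcard
    push_cast at hcard'
    rw [eq_sub_of_add_eq hcard']
    ring
  have htot := congrArg (Nat.cast : ℕ → ℂ) (card_filter_mem_notMem h)
  have hsum' := congrArg (Nat.cast : ℕ → ℂ) hsum
  rw [Nat.cast_sum, Finset.sum_congr rfl hfib, Finset.sum_const, nsmul_eq_mul] at hsum'
  push_cast at htot
  rw [hsum'] at htot
  have hq0 : (Fintype.card F : ℂ) ≠ 0 := by exact_mod_cast Fintype.card_ne_zero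
  have hd := finrank_mono h
  obtain ⟨d, hd⟩ := Nat.exists_eq_add_of_le hd
  rw [hd, Nat.add_sub_cancel_left, gaussC, eq_div_iff card_cast_sub_one_ne_zero]
  rw [hd, pow_add] at htot
  have hqu := pow_ne_zero (finrank F ↥u) hq0
  apply mul_left_cancel₀ hqu
  linear_combination htot

/-- The number of subspaces containing `a` and covered by a given overspace `u` of `a`. -/
theorem card_covers_ge [Fintype (Submodule F V)] {u a : Submodule F V} (h : a ≤ u) :
    ((Finset.univ.filter fun w => Covers w u ∧ a ≤ w).card : ℂ) =
      gaussC (Fintype.card F) (finrank F ↥u - finrank F ↥a) := by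
  have : Finite (Dual F V) := Module.finite_of_finite F
  have := Fintype.ofFinite (Submodule F (Dual F V))
  have hdual := card_covers_le (Subspace.dualAnnihilator_le_dualAnnihilator_iff.mpr h)
  have h1 := Subspace.finrank_add_finrank_dualAnnihilator_eq u
  have h2 := Subspace.finrank_add_finrank_dualAnnihilator_eq a
  have hd := finrank_mono h
  rw [show finrank F ↥u - finrank F ↥a =
    finrank F ↥a.dualAnnihilator - finrank F ↥u.dualAnnihilator by omega, ← hdual]
  congr 1
  refine Finset.card_bij (fun w _ => w.dualAnnihilator) ?_
    (fun _ _ _ _ hw => Subspace.dualAnnihilator_inj.mp hw) ?_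
  · intro w hw
    simpa only [Finset.mem_filter, Finset.mem_univ, true_and, dualAnnihilator_covers_iff,
      Subspace.dualAnnihilator_le_dualAnnihilator_iff] using hw
  · intro w hw
    refine ⟨w.dualCoannihilator, ?_, Subspace.dualCoannihilator_dualAnnihilator_eq⟩
    rw [← Subspace.dualCoannihilator_dualAnnihilator_eq (W := w)] at hw
    simpa only [Finset.mem_filter, Finset.mem_univ, true_and, dualAnnihilator_covers_iff,
      Subspace.dualAnnihilator_le_dualAnnihilator_iff] using hw

/-- The number of subspaces of `u` that slash-cover a given subspace `v` of `u`. -/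
theorem card_slashCovers_le [Fintype (Submodule F V)] (y : Submodule F V) {u v : Submodule F V}
    (h : v ≤ u) :
    ((Finset.univ.filter fun w => SlashCovers y v w ∧ w ≤ u).card : ℂ) =
      gaussC (Fintype.card F) (finrank F ↥(u ⊓ y) - finrank F ↥(v ⊓ y)) := by
  simp_rw [slashCovers_and_le_iff h]
  rw [card_covers_le le_sup_left]
  have h1 := finrank_sup_inf_add y h
  congr 1
  omega

/-- The number of subspaces of `u` that backslash-cover a given subspace `v` of `u`. -/
theorem card_backslashCovers_le [Fintype (Submodule F V)] (y : Submodule F V)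
    {u v : Submodule F V} (h : v ≤ u) :
    ((Finset.univ.filter fun w => BackslashCovers y v w ∧ w ≤ u).card : ℂ) =
      gaussC (Fintype.card F) (finrank F ↥u - finrank F ↥v) -
        gaussC (Fintype.card F) (finrank F ↥(u ⊓ y) - finrank F ↥(v ⊓ y)) := by
  rw [← card_covers_le h, ← card_slashCovers_le y h, eq_sub_iff_add_eq, ← Nat.cast_add,
    ← Finset.card_union_of_disjoint]
  · congr 2
    ext w
    simp only [Finset.mem_union, Finset.mem_filter, Finset.mem_univ, true_and,
      covers_iff_slashCovers_or_backslashCovers (y := y)]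
    tauto
  · rw [Finset.disjoint_left]
    intro w hw hw'
    have h1 := (Finset.mem_filter.mp hw).2.1.2
    have h2 := (Finset.mem_filter.mp hw').2.1.2
    omega

/-- The number of subspaces backslash-covered by `u`. -/
theorem card_backslashCovers_left [Fintype (Submodule F V)] (y u : Submodule F V) :
    ((Finset.univ.filter fun w => BackslashCovers y w u).card : ℂ) =
      gaussC (Fintype.card F) (finrank F ↥u - finrank F ↥(u ⊓ y)) := by
  rw [← card_covers_ge inf_le_left]
  congr 3
  ext w
  refine and_congr_right fun hc => ?_
  constructor
  · intro hw
    rw [← eq_of_le_of_finrank_eq (inf_le_inf_right y hc.1) hw.symm]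
    exact inf_le_left
  · intro hw
    exact le_antisymm (finrank_mono (le_inf hw inf_le_right)) (finrank_inf_le_of_le y hc.1)

end Counting

theorem not_slashCovers_self (y u : Submodule F V) : ¬ SlashCovers y u u :=
  fun h => by have := h.2; omega

theorem not_backslashCovers_self (y u : Submodule F V) : ¬ BackslashCovers y u u :=
  fun h => by have := h.1.2; omega

theorem sum_boole_mul_boole {ι : Type*} [Fintype ι] (p r : ι → Prop)
    [DecidablePred p] [DecidablePred r] :
    ∑ i, (if p i then (1 : ℂ) else 0) * (if r i then 1 else 0) =
      (Finset.univ.filter fun i => p i ∧ r i).card := by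
  rw [← Finset.sum_boole]
  exact Finset.sum_congr rfl fun i _ => by split_ifs <;> simp_all

theorem card_filter_eq_ite {ι : Type*} [Fintype ι] {p : ι → Prop} [DecidablePred p] (i : ι)
    (h : ∀ j, p j → j = i) :
    ((Finset.univ.filter p).card : ℂ) = if p i then 1 else 0 := by
  rw [← Finset.sum_boole, Finset.sum_eq_single i _ (by simp)]
  intro j _ hj
  rw [if_neg fun hp => hj (h j hp)]

theorem qpow_mul_qpow [Fintype F] (a b : ℝ) :
    qpow (Fintype.card F) a * qpow (Fintype.card F) b = qpow (Fintype.card F) (a + b) := by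
  have : (0 : ℝ) < Fintype.card F := by exact_mod_cast Fintype.card_pos
  rw [qpow, qpow, qpow, Real.rpow_add this, Complex.ofReal_mul]

theorem qpow_natCast (q m : ℕ) : qpow q m = (q : ℂ) ^ m := by
  rw [qpow, Real.rpow_natCast]
  push_cast
  rfl

theorem sub_one_mul_gaussC [Fintype F] (m : ℕ) :
    ((Fintype.card F : ℂ) - 1) * gaussC (Fintype.card F) m = (Fintype.card F : ℂ) ^ m - 1 :=
  mul_div_cancel₀ _ card_cast_sub_one_ne_zero

/-- The diagonal matrix whose `(u,u)` entry is a function of `dim u` and `dim (u ∩ y)`. -/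
def dimDiagonal (y : Submodule F V) (f : ℕ → ℕ → ℂ) :
    Matrix (Submodule F V) (Submodule F V) ℂ :=
  Matrix.diagonal fun u => f (finrank F ↥u) (finrank F ↥(u ⊓ y))

section Diagonal

variable [Fintype (Submodule F V)]

theorem dimDiagonal_mul_comm (y : Submodule F V) (f : ℕ → ℕ → ℂ)
    {M : Matrix (Submodule F V) (Submodule F V) ℂ}
    (hM : ∀ u v, M u v ≠ 0 →
      finrank F ↥u = finrank F ↥v ∧ finrank F ↥(u ⊓ y) = finrank F ↥(v ⊓ y)) :
    dimDiagonal y f * M = M * dimDiagonal y f := by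
  ext u v
  rw [dimDiagonal, Matrix.diagonal_mul, Matrix.mul_diagonal]
  by_cases h : M u v = 0
  · simp [h]
  · rw [(hM u v h).1, (hM u v h).2, mul_comm]

theorem dimDiagonal_mul_matF0 (y : Submodule F V) (f : ℕ → ℕ → ℂ) :
    dimDiagonal y f * matF0 y = matF0 y * dimDiagonal y f := by
  refine dimDiagonal_mul_comm y f fun u v h => ?_
  obtain ⟨⟨⟨-, h1⟩, h2⟩, ⟨⟨-, h3⟩, h4⟩, -⟩ := (ite_ne_right_iff.mp h).1
  omega

theorem dimDiagonal_mul_matFp (y : Submodule F V) (f : ℕ → ℕ → ℂ) :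
    dimDiagonal y f * matFp y = matFp y * dimDiagonal y f := by
  refine dimDiagonal_mul_comm y f fun u v h => ?_
  obtain ⟨⟨⟨-, h1⟩, h2⟩, ⟨⟨-, h3⟩, h4⟩⟩ := (ite_ne_right_iff.mp h).1
  omega

theorem dimDiagonal_mul_matFm (y : Submodule F V) (f : ℕ → ℕ → ℂ) :
    dimDiagonal y f * matFm y = matFm y * dimDiagonal y f := by
  refine dimDiagonal_mul_comm y f fun u v h => ?_
  obtain ⟨⟨⟨-, h1⟩, h2⟩, ⟨⟨-, h3⟩, h4⟩⟩ := (ite_ne_right_iff.mp h).1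
  omega

end Diagonal

theorem qpow_smul_matK1 [Fintype F] [FiniteDimensional F V] (y : Submodule F V) :
    qpow (Fintype.card F) ((finrank F ↥y : ℝ) / 2) • matK1 (Fintype.card F) (finrank F ↥y) y =
      ((Fintype.card F : ℂ) - 1) • dimDiagonal y
        (fun _ i => gaussC (Fintype.card F) (finrank F ↥y - i)) + 1 := by
  rw [matK1, dimDiagonal, ← Matrix.diagonal_smul, ← Matrix.diagonal_smul, ← Matrix.diagonal_one,
    Matrix.diagonal_add]
  congr 1
  ext u
  have hle : finrank F ↥(u ⊓ y) ≤ finrank F ↥y := finrank_mono inf_le_right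
  simp only [Pi.smul_apply, smul_eq_mul]
  rw [sub_one_mul_gaussC, sub_add_cancel, qpow_mul_qpow, ← qpow_natCast, Nat.cast_sub hle]
  congr 1
  ring

theorem qpow_smul_matK2 [Fintype F] [FiniteDimensional F V] (y : Submodule F V)
    (n k : ℕ) :
    qpow (Fintype.card F) (((n : ℝ) - (k : ℝ)) / 2) • matK2 (Fintype.card F) n k y =
      ((Fintype.card F : ℂ) - 1) • dimDiagonal y
        (fun d i => gaussC (Fintype.card F) (d - i)) + 1 := by
  rw [matK2, dimDiagonal, ← Matrix.diagonal_smul, ← Matrix.diagonal_smul, ← Matrix.diagonal_one,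
    Matrix.diagonal_add]
  congr 1
  ext u
  have hle : finrank F ↥(u ⊓ y) ≤ finrank F ↥u := finrank_mono inf_le_left
  simp only [Pi.smul_apply, smul_eq_mul]
  rw [sub_one_mul_gaussC, sub_add_cancel, qpow_mul_qpow, ← qpow_natCast, Nat.cast_sub hle]
  congr 1
  ring

theorem qpow_smul_matK1_mul_matK2 [Fintype F] [Fintype (Submodule F V)]
    (y : Submodule F V) (n k : ℕ) :
    qpow (Fintype.card F) ((n : ℝ) / 2) •
        (matK1 (Fintype.card F) k y * matK2 (Fintype.card F) n k y) =
      (qpow (Fintype.card F) ((k : ℝ) / 2) • matK1 (Fintype.card F) k y) *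
        (qpow (Fintype.card F) (((n : ℝ) - (k : ℝ)) / 2) • matK2 (Fintype.card F) n k y) := by
  rw [Matrix.smul_mul, Matrix.mul_smul, smul_smul, qpow_mul_qpow]
  congr 2
  ring

section Entries

variable [FiniteDimensional F V]

/-- The constraints on the dimensions attached to `u ⊓ v`, `u`, `v` and `u ⊔ v`. -/
theorem finrank_constraints (u v y : Submodule F V) :
    finrank F ↥(u ⊔ v) + finrank F ↥(u ⊓ v) = finrank F ↥u + finrank F ↥v ∧
    finrank F ↥(u ⊓ y) + finrank F ↥(v ⊓ y) ≤
      finrank F ↥((u ⊔ v) ⊓ y) + finrank F ↥((u ⊓ v) ⊓ y) ∧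
    finrank F ↥((u ⊓ v) ⊓ y) ≤ finrank F ↥(u ⊓ y) ∧
    finrank F ↥((u ⊓ v) ⊓ y) ≤ finrank F ↥(v ⊓ y) ∧
    finrank F ↥(u ⊓ y) ≤ finrank F ↥((u ⊔ v) ⊓ y) ∧
    finrank F ↥(v ⊓ y) ≤ finrank F ↥((u ⊔ v) ⊓ y) ∧
    finrank F ↥((u ⊔ v) ⊓ y) + finrank F ↥u ≤ finrank F ↥(u ⊔ v) + finrank F ↥(u ⊓ y) ∧
    finrank F ↥((u ⊔ v) ⊓ y) + finrank F ↥v ≤ finrank F ↥(u ⊔ v) + finrank F ↥(v ⊓ y) :=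
  ⟨finrank_sup_add_finrank_inf u v, finrank_inf_add_finrank_inf_le u v y,
    finrank_inf_le_of_le y inf_le_left, finrank_inf_le_of_le y inf_le_right,
    finrank_inf_le_of_le y le_sup_left, finrank_inf_le_of_le y le_sup_right,
    finrank_inf_add_finrank_le y le_sup_left, finrank_inf_add_finrank_le y le_sup_right⟩

theorem slashCovers_sup_and_iff {y u v : Submodule F V} :
    SlashCovers y u (u ⊔ v) ∧ SlashCovers y v (u ⊔ v) ↔
      (SlashCovers y u (u ⊔ v) ∧ SlashCovers y v (u ⊔ v) ∧
        BackslashCovers y (u ⊓ v) u ∧ BackslashCovers y (u ⊓ v) v) ∨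
      (SlashCovers y (u ⊓ v) u ∧ SlashCovers y (u ⊓ v) v) := by
  have := finrank_constraints u v y
  simp only [SlashCovers, BackslashCovers, Covers, le_sup_left, le_sup_right, inf_le_left,
    inf_le_right, true_and]
  omega

theorem backslashCovers_inf_and_iff {y u v : Submodule F V} :
    BackslashCovers y (u ⊓ v) u ∧ BackslashCovers y (u ⊓ v) v ↔
      (SlashCovers y u (u ⊔ v) ∧ SlashCovers y v (u ⊔ v) ∧
        BackslashCovers y (u ⊓ v) u ∧ BackslashCovers y (u ⊓ v) v) ∨
      (BackslashCovers y u (u ⊔ v) ∧ BackslashCovers y v (u ⊔ v)) := by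
  have := finrank_constraints u v y
  simp only [SlashCovers, BackslashCovers, Covers, le_sup_left, le_sup_right, inf_le_left,
    inf_le_right, true_and]
  omega

theorem backslashCovers_inf_and_slashCovers_inf_iff {y u v : Submodule F V} :
    BackslashCovers y (u ⊓ v) u ∧ SlashCovers y (u ⊓ v) v ↔
      SlashCovers y u (u ⊔ v) ∧ BackslashCovers y v (u ⊔ v) := by
  have := finrank_constraints u v y
  simp only [SlashCovers, BackslashCovers, Covers, le_sup_left, le_sup_right, inf_le_left,
    inf_le_right, true_and]
  omega

variable [Fintype (Submodule F V)]

theorem matR2_mul_matL1 (y : Submodule F V) : matR2 y * matL1 y = matL1 y * matR2 y := by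
  ext u v
  simp only [Matrix.mul_apply, matL1, matR2, matL2, Matrix.transpose_apply, Matrix.of_apply,
    sum_boole_mul_boole]
  by_cases huv : u = v
  · subst huv
    congr 3
    ext w
    constructor
    · rintro ⟨h1, h2⟩
      have := h1.2
      have := h2.2
      omega
    · rintro ⟨h1, h2⟩
      have := h1.2
      have := h2.2
      omega
  · rw [card_filter_eq_ite (u ⊓ v) fun w hw => hw.1.1.eq_inf hw.2.1 huv,
      card_filter_eq_ite (u ⊔ v) fun w hw => hw.1.1.eq_sup hw.2.1 huv]
    exact if_congr backslashCovers_inf_and_slashCovers_inf_iff rfl rfl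

theorem matR1_mul_matL2 (y : Submodule F V) : matR1 y * matL2 y = matL2 y * matR1 y := by
  have h := congrArg Matrix.transpose (matR2_mul_matL1 y)
  simpa only [Matrix.transpose_mul, matR1, matR2, Matrix.transpose_transpose] using h

variable [Fintype F]

theorem matL1_mul_matR1 (y : Submodule F V) :
    matL1 y * matR1 y = matF0 y + matFm y + dimDiagonal y
      (fun _ i => gaussC (Fintype.card F) (finrank F ↥y - i)) := by
  ext u v
  simp only [Matrix.mul_apply, Matrix.add_apply, matL1, matR1, matF0, matFm, dimDiagonal,
    Matrix.transpose_apply, Matrix.of_apply, sum_boole_mul_boole]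
  by_cases huv : u = v
  · subst huv
    have h := card_slashCovers_le y (le_top : u ≤ ⊤)
    simp only [le_top, and_true] at h
    rw [top_inf_eq] at h
    simp [not_slashCovers_self, h]
  · rw [card_filter_eq_ite (u ⊔ v) fun w hw => hw.1.1.eq_sup hw.2.1 huv,
      if_congr slashCovers_sup_and_iff rfl rfl, Matrix.diagonal_apply_ne _ huv, add_zero]
    split_ifs with h1 h2 h3 <;> simp_all
    have := h2.2.2.1.2
    have := h3.1.2
    omega

theorem matR2_mul_matL2 (y : Submodule F V) :
    matR2 y * matL2 y = matF0 y + matFp y + dimDiagonal y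
      (fun d i => gaussC (Fintype.card F) (d - i)) := by
  ext u v
  simp only [Matrix.mul_apply, Matrix.add_apply, matL2, matR2, matF0, matFp, dimDiagonal,
    Matrix.transpose_apply, Matrix.of_apply, sum_boole_mul_boole]
  by_cases huv : u = v
  · subst huv
    simp [not_slashCovers_self, not_backslashCovers_self, card_backslashCovers_left]
  · rw [card_filter_eq_ite (u ⊓ v) fun w hw => hw.1.1.eq_inf hw.2.1 huv,
      if_congr backslashCovers_inf_and_iff rfl rfl, Matrix.diagonal_apply_ne _ huv, add_zero]
    split_ifs with h1 h2 h3 <;> simp_all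
    have := h2.1.2
    have := h3.1.2
    omega

theorem matL2_mul_matR2 (y : Submodule F V) :
    matL2 y * matR2 y = matFp y + dimDiagonal y
      (fun d i => gaussC (Fintype.card F) (finrank F V - d) -
        gaussC (Fintype.card F) (finrank F ↥y - i)) := by
  ext u v
  simp only [Matrix.mul_apply, Matrix.add_apply, matL2, matR2, matFp, dimDiagonal,
    Matrix.transpose_apply, Matrix.of_apply, sum_boole_mul_boole]
  by_cases huv : u = v
  · subst huv
    have h := card_backslashCovers_le y (le_top : u ≤ ⊤)
    simp only [le_top, and_true, finrank_top] at h
    rw [top_inf_eq] at h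
    simp [not_backslashCovers_self, h]
  · rw [card_filter_eq_ite (u ⊔ v) fun w hw => hw.1.1.eq_sup hw.2.1 huv,
      Matrix.diagonal_apply_ne _ huv, add_zero]

theorem matR1_mul_matR2 (y : Submodule F V) :
    matR1 y * matR2 y = (Fintype.card F : ℂ) • (matR2 y * matR1 y) := by
  ext u v
  simp only [Matrix.mul_apply, Matrix.smul_apply, smul_eq_mul, matL1, matL2, matR1, matR2,
    Matrix.transpose_apply, Matrix.of_apply, sum_boole_mul_boole]
  by_cases h : v ≤ u ∧ finrank F ↥u = finrank F ↥v + 2 ∧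
      finrank F ↥(u ⊓ y) = finrank F ↥(v ⊓ y) + 1
  · obtain ⟨hle, hd, hi⟩ := h
    have h1 (w : Submodule F V) : SlashCovers y w u ∧ BackslashCovers y v w ↔
        BackslashCovers y v w ∧ w ≤ u := by
      simp only [SlashCovers, BackslashCovers, Covers]
      constructor
      · tauto
      · intro ⟨⟨⟨hvw, hw1⟩, hw2⟩, hwu⟩
        exact ⟨⟨⟨hwu, by omega⟩, by omega⟩, ⟨hvw, hw1⟩, hw2⟩
    have h2 (w : Submodule F V) : BackslashCovers y w u ∧ SlashCovers y v w ↔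
        SlashCovers y v w ∧ w ≤ u := by
      simp only [SlashCovers, BackslashCovers, Covers]
      constructor
      · tauto
      · intro ⟨⟨⟨hvw, hw1⟩, hw2⟩, hwu⟩
        exact ⟨⟨⟨hwu, by omega⟩, by omega⟩, ⟨hvw, hw1⟩, hw2⟩
    have hq := card_cast_sub_one_ne_zero (F := F)
    simp_rw [h1, h2]
    rw [card_slashCovers_le y hle, card_backslashCovers_le y hle, hd, hi,
      Nat.add_sub_cancel_left, Nat.add_sub_cancel_left, gaussC, gaussC]
    field_simp
    ring
  · rw [Finset.filter_eq_empty_iff.mpr, Finset.filter_eq_empty_iff.mpr]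
    · simp
    all_goals
      rintro w - ⟨⟨⟨h1, h2⟩, h3⟩, ⟨h4, h5⟩, h6⟩
      exact h ⟨h4.trans h1, by omega, by omega⟩

theorem matL2_mul_matL1 (y : Submodule F V) :
    matL2 y * matL1 y = (Fintype.card F : ℂ) • (matL1 y * matL2 y) := by
  have h := congrArg Matrix.transpose (matR1_mul_matR2 y)
  simpa only [Matrix.transpose_mul, Matrix.transpose_smul, matR1, matR2,
    Matrix.transpose_transpose] using h

/-- `L1 R1` and `L2 R2` commute. -/
theorem matL1_mul_matR1_mul_matL2_mul_matR2 (y : Submodule F V) :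
    matL1 y * matR1 y * (matL2 y * matR2 y) = matL2 y * matR2 y * (matL1 y * matR1 y) := by
  calc matL1 y * matR1 y * (matL2 y * matR2 y)
      = matL1 y * (matR1 y * matL2 y) * matR2 y := by simp only [Matrix.mul_assoc]
    _ = matL1 y * matL2 y * (matR1 y * matR2 y) := by
      rw [matR1_mul_matL2]; simp only [Matrix.mul_assoc]
    _ = matL2 y * matL1 y * (matR2 y * matR1 y) := by
      rw [matR1_mul_matR2, matL2_mul_matL1, Matrix.mul_smul, Matrix.smul_mul]
    _ = matL2 y * (matR2 y * matL1 y) * matR1 y := by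
      rw [matR2_mul_matL1]; simp only [Matrix.mul_assoc]
    _ = matL2 y * matR2 y * (matL1 y * matR1 y) := by simp only [Matrix.mul_assoc]

theorem matFp_mul_matF0_add_matFm (y : Submodule F V) :
    matFp y * (matF0 y + matFm y) = (matF0 y + matFm y) * matFp y := by
  have h := matL1_mul_matR1_mul_matL2_mul_matR2 y
  rw [matL1_mul_matR1, matL2_mul_matR2] at h
  set D := dimDiagonal y fun _ i => gaussC (Fintype.card F) (finrank F ↥y - i)
  set E := dimDiagonal y fun d i => gaussC (Fintype.card F) (finrank F V - d) -
    gaussC (Fintype.card F) (finrank F ↥y - i)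
  have hD : D * matFp y = matFp y * D := dimDiagonal_mul_matFp y _
  have hE0 : E * matF0 y = matF0 y * E := dimDiagonal_mul_matF0 y _
  have hEm : E * matFm y = matFm y * E := dimDiagonal_mul_matFm y _
  have hDE : D * E = E * D := (Matrix.commute_diagonal _ _).eq
  simp only [Matrix.add_mul, Matrix.mul_add, hD, hE0, hEm, hDE] at h ⊢
  rw [← sub_eq_zero] at h ⊢
  rw [← neg_eq_zero, ← h]
  abel

/-- The product `R L` in terms of `L1 R1` and `R2 L2`. -/
theorem smul_matR_mul_matL (y : Submodule F V) :
    (Fintype.card F : ℂ) • (matR y * matL y) = matL1 y * matR1 y * (matR2 y * matL2 y) := by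
  calc (Fintype.card F : ℂ) • (matR y * matL y)
      = matL1 y * ((Fintype.card F : ℂ) • (matR2 y * matR1 y)) * matL2 y := by
        simp only [matR, matL, Matrix.mul_assoc, Matrix.mul_smul, Matrix.smul_mul]
    _ = matL1 y * matR1 y * (matR2 y * matL2 y) := by
        rw [← matR1_mul_matR2]; simp only [Matrix.mul_assoc]

end Entries

theorem statement7
    (q n k : ℕ) (hq : IsPrimePow q) (hkn : k < n) (hk : 1 ≤ k)
    (F V : Type) [Field F] [Fintype F] (hcard : Fintype.card F = q)
    [AddCommGroup V] [Module F V] [FiniteDimensional F V]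
    (hdim : Module.finrank F V = n)
    [Fintype (Submodule F V)]
    (y : Submodule F V) (hy : Module.finrank F ↥y = k) :
    (q : ℂ) • (matR y * matL y) =
      (matF0 y + matFp y + matFm y) * matF0 y + matFp y * matFm y +
      ((q : ℂ) - 1)⁻¹ • ((qpow q ((k : ℝ) / 2) • matK1 q k y
          + qpow q (((n : ℝ) - (k : ℝ)) / 2) • matK2 q n k y
          - (2 : ℂ) • (1 : Matrix (Submodule F V) (Submodule F V) ℂ)) * matF0 y
        + (qpow q ((k : ℝ) / 2) • matK1 q k y - (1 : Matrix (Submodule F V) (Submodule F V) ℂ)) * matFp y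
        + (qpow q (((n : ℝ) - (k : ℝ)) / 2) • matK2 q n k y - (1 : Matrix (Submodule F V) (Submodule F V) ℂ)) * matFm y) +
      (((q : ℂ) - 1)⁻¹) ^ 2 • (qpow q ((n : ℝ) / 2) • (matK1 q k y * matK2 q n k y)
        - qpow q ((k : ℝ) / 2) • matK1 q k y - qpow q (((n : ℝ) - (k : ℝ)) / 2) • matK2 q n k y
        + (1 : Matrix (Submodule F V) (Submodule F V) ℂ)) := by
  subst hcard hdim hy
  have hne := card_cast_sub_one_ne_zero (F := F)
  have hcomm := matFp_mul_matF0_add_matFm y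
  rw [qpow_smul_matK1_mul_matK2, qpow_smul_matK1, qpow_smul_matK2, smul_matR_mul_matL,
    matL1_mul_matR1, matR2_mul_matL2]
  set D := dimDiagonal y fun _ i => gaussC (Fintype.card F) (finrank F ↥y - i)
  set E := dimDiagonal y fun d i => gaussC (Fintype.card F) (d - i)
  have hE0 : E * matF0 y = matF0 y * E := dimDiagonal_mul_matF0 y _
  have hEm : E * matFm y = matFm y * E := dimDiagonal_mul_matFm y _
  set c := (Fintype.card F : ℂ) - 1
  simp only [Matrix.add_mul, Matrix.mul_add, Matrix.sub_mul, Matrix.smul_mul, Matrix.mul_smul,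
    Matrix.one_mul, Matrix.mul_one, hE0, hEm] at hcomm ⊢
  rw [eq_comm, ← sub_eq_iff_eq_add] at hcomm
  rw [← hcomm]
  match_scalars <;> field_simp <;> ring
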